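/- Let X ⊆ ℝⁿ be a compact set, A a real p×n matrix, B a real p×m matrix, d ∈ ℝᵖ, and f : ℝⁿ → ℝ be upper semicontinuous and nonnegative on X. Let q : ℝⁿ → ℝ satisfy q(x) = f(x)² for all x ∈ X, and let q̂ be the concave envelope of q over conv(X). Then the convex hull of Z = { (x,y) ∈ X × ℝᵐ : ‖Ax + By + d‖₂ ≤ f(x) } is contained in the set R = { (x,y) ∈ conv(X) × ℝᵐ : ‖Ax + By + d‖₂ ≤ √(q̂(x)) }, and R is convex. -/

import Mathlib

open Finset Matrix

/-- The Euclidean norm on `ℝᵖ`. -/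
noncomputable def euclNorm {p : ℕ} (v : Fin p → ℝ) : ℝ := Real.sqrt (∑ i, v i ^ 2)

/-- The concave envelope of `f` over `conv(X)`. -/
noncomputable def concaveEnvelope {n : ℕ} (X : Set (Fin n → ℝ)) (f : (Fin n → ℝ) → ℝ)
    (x : Fin n → ℝ) : ℝ :=
  sSup { s : ℝ | ∃ (lam : Fin (n + 1) → ℝ) (xs : Fin (n + 1) → Fin n → ℝ),
    (∀ k, 0 ≤ lam k) ∧ (∑ k, lam k = 1) ∧ (∀ k, xs k ∈ X) ∧
    (∑ k, lam k • xs k = x) ∧ s = ∑ k, lam k * f (xs k) }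

/-- Carathéodory reduction for a convex combination which does not decrease a linear objective
in the weights. -/
lemma exists_convexCombination_card_le {ι : Type*} {n : ℕ} (z : ι → Fin n → ℝ) (g : ι → ℝ)
    (t : Finset ι) (w : ι → ℝ) (hw : ∀ i ∈ t, 0 ≤ w i) :
    ∃ s ⊆ t, ∃ w' : ι → ℝ, (∀ i ∈ s, 0 ≤ w' i) ∧ ∑ i ∈ s, w' i = ∑ i ∈ t, w i ∧
      ∑ i ∈ s, w' i • z i = ∑ i ∈ t, w i • z i ∧
      ∑ i ∈ t, w i * g i ≤ ∑ i ∈ s, w' i * g i ∧ s.card ≤ n + 1 := by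
  classical
  induction t using Finset.strongInduction generalizing w with
  | H t ih =>
  by_cases ht : t.card ≤ n + 1
  · exact ⟨t, subset_refl t, w, hw, rfl, rfl, le_rfl, ht⟩
  have hdep : ¬ LinearIndepOn ℝ (fun i => (z i, (1 : ℝ))) (t : Set ι) := by
    intro h
    have := LinearIndependent.fintype_card_le_finrank h
    simp at this
    omega
  obtain ⟨c, hc, j, hj, hcj⟩ : ∃ c : ι → ℝ, ∑ i ∈ t, c i • (z i, (1 : ℝ)) = 0 ∧
      ∃ j ∈ t, c j ≠ 0 := by
    simpa using (not_linearIndepOn_finset_iff.1 hdep)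
  have hcz : ∑ i ∈ t, c i • z i = 0 := by
    simpa [Prod.fst_sum] using congrArg Prod.fst hc
  have hc1 : ∑ i ∈ t, c i = 0 := by
    simpa [Prod.snd_sum] using congrArg Prod.snd hc
  obtain ⟨c, hcz, hc1, hcj, hcg⟩ : ∃ c : ι → ℝ, ∑ i ∈ t, c i • z i = 0 ∧ ∑ i ∈ t, c i = 0 ∧
      c j ≠ 0 ∧ 0 ≤ ∑ i ∈ t, c i * g i := by
    rcases le_total 0 (∑ i ∈ t, c i * g i) with h | h
    · exact ⟨c, hcz, hc1, hcj, h⟩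
    · exact ⟨-c, by simp [hcz], by simp [hc1], by simpa using hcj, by simpa using h⟩
  have hneg : (t.filter (fun i => c i < 0)).Nonempty := by
    by_contra hne
    have hnn : ∀ i ∈ t, 0 ≤ c i := by
      intro i hi
      by_contra hlt
      exact hne ⟨i, by simp [hi, not_le.1 hlt]⟩
    exact hcj ((Finset.sum_eq_zero_iff_of_nonneg hnn).1 hc1 j hj)
  obtain ⟨k, hk, hmin⟩ := Finset.exists_min_image _ (fun i => w i / (-c i)) hneg
  obtain ⟨hkt, hck⟩ := Finset.mem_filter.1 hk
  set θ := w k / (-c k) with hθ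
  have hθ0 : 0 ≤ θ := div_nonneg (hw k hkt) (by linarith)
  have hvk : w k + θ * c k = 0 := by
    rw [hθ, div_neg, neg_mul, div_mul_cancel₀ _ hck.ne, add_neg_cancel]
  have hv : ∀ i ∈ t.erase k, 0 ≤ w i + θ * c i := by
    intro i hi
    have hit := Finset.mem_of_mem_erase hi
    rcases le_or_gt 0 (c i) with h | h
    · have := hw i hit
      positivity
    · have := hmin i (Finset.mem_filter.2 ⟨hit, h⟩)
      rw [le_div_iff₀ (by linarith)] at this
      linarith
  obtain ⟨s, hs, w', h0, h1, hz, hg, hcard⟩ :=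
    ih (t.erase k) (Finset.erase_ssubset hkt) (fun i => w i + θ * c i) hv
  refine ⟨s, hs.trans (Finset.erase_subset _ _), w', h0, h1.trans ?_, hz.trans ?_,
    le_trans ?_ hg, hcard⟩
  · rw [Finset.sum_erase (f := fun i => w i + θ * c i) _ hvk, Finset.sum_add_distrib, ← Finset.mul_sum, hc1]
    simp
  · rw [Finset.sum_erase _ (by simp only [hvk, zero_smul])]
    simp only [add_smul, mul_smul]
    rw [Finset.sum_add_distrib, ← Finset.smul_sum, hcz]
    simp
  · rw [Finset.sum_erase _ (by simp only [hvk, zero_mul])]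
    simp only [add_mul, mul_assoc]
    rw [Finset.sum_add_distrib, ← Finset.mul_sum]
    have := mul_nonneg hθ0 hcg
    linarith

/-- The values whose supremum is the concave envelope. -/
def envelopeValues {n : ℕ} (X : Set (Fin n → ℝ)) (f : (Fin n → ℝ) → ℝ) (x : Fin n → ℝ) : Set ℝ :=
  { s : ℝ | ∃ (lam : Fin (n + 1) → ℝ) (xs : Fin (n + 1) → Fin n → ℝ),
    (∀ k, 0 ≤ lam k) ∧ (∑ k, lam k = 1) ∧ (∀ k, xs k ∈ X) ∧
    (∑ k, lam k • xs k = x) ∧ s = ∑ k, lam k * f (xs k) }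

lemma concaveEnvelope_eq_sSup {n : ℕ} (X : Set (Fin n → ℝ)) (f : (Fin n → ℝ) → ℝ)
    (x : Fin n → ℝ) : concaveEnvelope X f x = sSup (envelopeValues X f x) := rfl

lemma exists_mem_envelopeValues_ge {ι : Type*} [Fintype ι] {n : ℕ} {X : Set (Fin n → ℝ)}
    (f : (Fin n → ℝ) → ℝ) (z : ι → Fin n → ℝ) (hz : ∀ i, z i ∈ X) (w : ι → ℝ)
    (hw : ∀ i, 0 ≤ w i) (hw1 : ∑ i, w i = 1) :
    ∃ s ∈ envelopeValues X f (∑ i, w i • z i), ∑ i, w i * f (z i) ≤ s := by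
  classical
  obtain ⟨s, -, w', h0, h1, hzs, hg, hcard⟩ :=
    exists_convexCombination_card_le z (fun i => f (z i)) Finset.univ w (fun i _ => hw i)
  obtain ⟨e⟩ : Nonempty (s ↪ Fin (n + 1)) :=
    Function.Embedding.nonempty_of_card_le (by simpa using hcard)
  obtain ⟨i₀⟩ : Nonempty ι := by
    by_contra h
    rw [not_nonempty_iff] at h
    simp at hw1
  set lam := Function.extend e (fun i : s => w' i) 0 with hlam
  set xs := Function.extend e (fun i : s => z i) (fun _ => z i₀) with hxs
  have hle (i : s) : lam (e i) = w' i := e.injective.extend_apply _ _ i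
  have hxe (i : s) : xs (e i) = z i := e.injective.extend_apply _ _ i
  have hl0 (k) (hk : k ∉ Set.range e) : lam k = 0 :=
    Function.extend_apply' _ _ _ (by simpa using hk)
  refine ⟨∑ k, lam k * f (xs k), ⟨lam, xs, fun k => ?_, ?_, fun k => ?_, ?_, rfl⟩, hg.trans ?_⟩
  · by_cases hk : k ∈ Set.range e
    · obtain ⟨i, rfl⟩ := hk
      rw [hle]
      exact h0 i i.2
    · rw [hl0 k hk]
  · rw [← hw1, ← h1, ← Finset.sum_coe_sort s]
    exact (Fintype.sum_of_injective e e.injective _ _ hl0 fun i => (hle i).symm).symm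
  · by_cases hk : k ∈ Set.range e
    · obtain ⟨i, rfl⟩ := hk
      rw [hxe]
      exact hz i
    · rw [hxs, Function.extend_apply' _ _ _ (by simpa using hk)]
      exact hz i₀
  · rw [← hzs, ← Finset.sum_coe_sort s]
    refine (Fintype.sum_of_injective e e.injective _ _ (fun k hk => ?_) fun i => ?_).symm
    · rw [hl0 k hk, zero_smul]
    · rw [hle, hxe]
  · rw [← Finset.sum_coe_sort s]
    refine (Fintype.sum_of_injective e e.injective _ _ (fun k hk => ?_) fun i => ?_).le
    · rw [hl0 k hk, zero_mul]
    · rw [hle, hxe]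

lemma bddAbove_envelopeValues {n : ℕ} {X : Set (Fin n → ℝ)} {f : (Fin n → ℝ) → ℝ}
    (hf : BddAbove (f '' X)) (x : Fin n → ℝ) : BddAbove (envelopeValues X f x) := by
  obtain ⟨M, hM⟩ := hf
  refine ⟨M, ?_⟩
  rintro _ ⟨lam, xs, h0, h1, hX, -, rfl⟩
  calc ∑ k, lam k * f (xs k) ≤ ∑ k, lam k * M :=
        Finset.sum_le_sum fun k _ =>
          mul_le_mul_of_nonneg_left (hM (Set.mem_image_of_mem f (hX k))) (h0 k)
    _ = M := by rw [← Finset.sum_mul, h1, one_mul]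

lemma sum_le_concaveEnvelope {ι : Type*} [Fintype ι] {n : ℕ} {X : Set (Fin n → ℝ)}
    {f : (Fin n → ℝ) → ℝ} (hf : BddAbove (f '' X)) (z : ι → Fin n → ℝ) (hz : ∀ i, z i ∈ X)
    (w : ι → ℝ) (hw : ∀ i, 0 ≤ w i) (hw1 : ∑ i, w i = 1) :
    ∑ i, w i * f (z i) ≤ concaveEnvelope X f (∑ i, w i • z i) := by
  obtain ⟨s, hs, hle⟩ := exists_mem_envelopeValues_ge f z hz w hw hw1
  exact hle.trans (le_csSup (bddAbove_envelopeValues hf _) hs)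

lemma envelopeValues_nonempty {n : ℕ} {X : Set (Fin n → ℝ)} (f : (Fin n → ℝ) → ℝ)
    {x : Fin n → ℝ} (hx : x ∈ convexHull ℝ X) : (envelopeValues X f x).Nonempty := by
  obtain ⟨ι, _, w, z, h0, h1, hz, rfl⟩ := mem_convexHull_iff_exists_fintype.1 hx
  obtain ⟨s, hs, -⟩ := exists_mem_envelopeValues_ge f z hz w h0 h1
  exact ⟨s, hs⟩

lemma concaveEnvelope_nonneg {n : ℕ} {X : Set (Fin n → ℝ)} {f : (Fin n → ℝ) → ℝ}
    (hf0 : ∀ x ∈ X, 0 ≤ f x) (x : Fin n → ℝ) : 0 ≤ concaveEnvelope X f x := by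
  refine Real.sSup_nonneg ?_
  rintro _ ⟨lam, xs, h0, -, hX, -, rfl⟩
  exact Finset.sum_nonneg fun k _ => mul_nonneg (h0 k) (hf0 _ (hX k))

lemma le_concaveEnvelope {n : ℕ} {X : Set (Fin n → ℝ)} {f : (Fin n → ℝ) → ℝ}
    (hf : BddAbove (f '' X)) {x : Fin n → ℝ} (hx : x ∈ X) : f x ≤ concaveEnvelope X f x := by
  simpa using sum_le_concaveEnvelope hf (fun _ : Unit => x) (fun _ => hx) (fun _ => 1)
    (fun _ => zero_le_one) (by simp)

lemma concaveOn_concaveEnvelope {n : ℕ} {X : Set (Fin n → ℝ)} {f : (Fin n → ℝ) → ℝ}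
    (hf : BddAbove (f '' X)) : ConcaveOn ℝ (convexHull ℝ X) (concaveEnvelope X f) := by
  refine ⟨convex_convexHull ℝ X, fun x hx y hy a b ha hb hab => ?_⟩
  have key : ∀ u ∈ envelopeValues X f x, ∀ v ∈ envelopeValues X f y,
      a * u + b * v ≤ concaveEnvelope X f (a • x + b • y) := by
    rintro _ ⟨l₁, z₁, hl₁, hs₁, hz₁, rfl, rfl⟩ _ ⟨l₂, z₂, hl₂, hs₂, hz₂, rfl, rfl⟩
    have h := sum_le_concaveEnvelope hf (Sum.elim z₁ z₂) (by rintro (i | i) <;> simp [hz₁, hz₂])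
      (Sum.elim (fun i => a * l₁ i) (fun i => b * l₂ i))
      (by rintro (i | i) <;> simp [mul_nonneg, *])
      (by simp [← Finset.mul_sum, hs₁, hs₂, hab])
    simpa [mul_assoc, mul_smul, ← Finset.mul_sum, ← Finset.smul_sum] using h
  have hxne := envelopeValues_nonempty f hx
  have hyne := envelopeValues_nonempty f hy
  simp only [smul_eq_mul]
  rw [concaveEnvelope_eq_sSup X f x, concaveEnvelope_eq_sSup X f y,
    ← smul_eq_mul, ← smul_eq_mul, ← Real.sSup_smul_of_nonneg ha, ← Real.sSup_smul_of_nonneg hb,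
    ← le_sub_iff_add_le]
  refine csSup_le hxne.smul_set ?_
  rintro _ ⟨u, hu, rfl⟩
  rw [le_sub_comm]
  refine csSup_le hyne.smul_set ?_
  rintro _ ⟨v, hv, rfl⟩
  have := key u hu v hv
  simp only [smul_eq_mul]
  linarith

lemma euclNorm_eq_norm {p : ℕ} (v : Fin p → ℝ) : euclNorm v = ‖WithLp.toLp 2 v‖ := by
  simp [euclNorm, EuclideanSpace.norm_eq]

lemma convexOn_euclNorm {p : ℕ} : ConvexOn ℝ Set.univ (euclNorm : (Fin p → ℝ) → ℝ) := by
  refine ⟨convex_univ, fun u _ v _ a b ha hb _ => ?_⟩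
  simp only [euclNorm_eq_norm, WithLp.toLp_add, WithLp.toLp_smul, smul_eq_mul]
  refine (norm_add_le _ _).trans ?_
  simp [norm_smul, abs_of_nonneg ha, abs_of_nonneg hb]

theorem convexHull_subset_sqrt_envelope_relaxation
    {n m p : ℕ} (X : Set (Fin n → ℝ)) (hX : IsCompact X)
    (A : Matrix (Fin p) (Fin n) ℝ) (B : Matrix (Fin p) (Fin m) ℝ) (d : Fin p → ℝ)
    (f : (Fin n → ℝ) → ℝ) (hf : UpperSemicontinuousOn f X)
    (hf0 : ∀ x ∈ X, 0 ≤ f x)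
    (q : (Fin n → ℝ) → ℝ) (hq : ∀ x ∈ X, q x = f x ^ 2) :
    convexHull ℝ {z : (Fin n → ℝ) × (Fin m → ℝ) | z.1 ∈ X ∧
        euclNorm (A.mulVec z.1 + B.mulVec z.2 + d) ≤ f z.1}
      ⊆ {z : (Fin n → ℝ) × (Fin m → ℝ) | z.1 ∈ convexHull ℝ X ∧
        euclNorm (A.mulVec z.1 + B.mulVec z.2 + d) ≤ Real.sqrt (concaveEnvelope X q z.1)} ∧
    Convex ℝ {z : (Fin n → ℝ) × (Fin m → ℝ) | z.1 ∈ convexHull ℝ X ∧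
        euclNorm (A.mulVec z.1 + B.mulVec z.2 + d) ≤ Real.sqrt (concaveEnvelope X q z.1)} := by
  obtain ⟨M, hM⟩ := hf.bddAbove_of_isCompact hX
  have hbdd : BddAbove (q '' X) := by
    refine ⟨M ^ 2, ?_⟩
    rintro _ ⟨x, hx, rfl⟩
    rw [hq x hx]
    exact pow_le_pow_left₀ (hf0 x hx) (hM (Set.mem_image_of_mem f hx)) 2
  have hq0 : ∀ x ∈ X, 0 ≤ q x := fun x hx => hq x hx ▸ sq_nonneg _
  have hconv : Convex ℝ {z : (Fin n → ℝ) × (Fin m → ℝ) | z.1 ∈ convexHull ℝ X ∧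
      euclNorm (A.mulVec z.1 + B.mulVec z.2 + d) ≤ Real.sqrt (concaveEnvelope X q z.1)} := by
    rintro ⟨x, y⟩ ⟨hx, hxy⟩ ⟨x', y'⟩ ⟨hx', hxy'⟩ a b ha hb hab
    refine ⟨convex_convexHull ℝ X hx hx' ha hb hab, ?_⟩
    dsimp only at hx hxy hx' hxy'
    have haff : A.mulVec (a • x + b • x') + B.mulVec (a • y + b • y') + d =
        a • (A.mulVec x + B.mulVec y + d) + b • (A.mulVec x' + B.mulVec y' + d) := by
      have hd : d = a • d + b • d := by rw [← add_smul, hab, one_smul]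
      simp only [Matrix.mulVec_add, Matrix.mulVec_smul, smul_add]
      nth_rewrite 1 [hd]
      abel
    change euclNorm (A.mulVec (a • x + b • x') + B.mulVec (a • y + b • y') + d) ≤
      Real.sqrt (concaveEnvelope X q (a • x + b • x'))
    rw [haff]
    calc _ ≤ a * euclNorm (A.mulVec x + B.mulVec y + d) +
          b * euclNorm (A.mulVec x' + B.mulVec y' + d) :=
          convexOn_euclNorm.2 trivial trivial ha hb hab
      _ ≤ a * Real.sqrt (concaveEnvelope X q x) + b * Real.sqrt (concaveEnvelope X q x') := by
          gcongr
      _ ≤ Real.sqrt (a * concaveEnvelope X q x + b * concaveEnvelope X q x') :=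
          Real.strictConcaveOn_sqrt.concaveOn.2 (concaveEnvelope_nonneg hq0 x)
            (concaveEnvelope_nonneg hq0 x') ha hb hab
      _ ≤ _ := Real.sqrt_le_sqrt ((concaveOn_concaveEnvelope hbdd).2 hx hx' ha hb hab)
  refine ⟨convexHull_min ?_ hconv, hconv⟩
  rintro ⟨x, y⟩ ⟨hx, hxy⟩
  refine ⟨subset_convexHull ℝ X hx, hxy.trans (Real.le_sqrt_of_sq_le ?_)⟩
  exact hq x hx ▸ le_concaveEnvelope hbdd hx
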